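/- For the asymmetric two-node SICA network, the spectral radius of the next-generation matrix F₀V₀⁻¹ equals max{R_{0,1}, R_{0,2}}, where R_{0,2} = N₂(Λ₁L_{2,1}ε_S + Λ₂L_{2,1}ε_S + Λ₂μ₁)/(D₂(L_{2,1}ε_S + μ₁)μ₂); in particular the nonzero eigenvalues of F₀V₀⁻¹ are exactly R_{0,1} and R_{0,2}. -/

import Mathlib

open Matrix

lemma aux_det4 (a b c d e f g h i k l : ℝ) :
    (!![a, b, c, d; 0, e, f, g; 0, h, i, 0; 0, k, 0, l] : Matrix (Fin 4) (Fin 4) ℝ).det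
      = a * (e * i * l - f * h * l - g * k * i) := by
  rw [Matrix.det_succ_column_zero]
  simp [Fin.sum_univ_succ, Matrix.det_fin_three, Matrix.submatrix]
  left
  ring

lemma aux_det8 (a b c d e f g h i k l a' b' c' d' e' f' g' h' i' k' l' : ℝ)
    (C : Matrix (Fin 4) (Fin 4) ℝ) :
    (!![a, b, c, d, 0, 0, 0, 0;
        0, e, f, g, 0, 0, 0, 0;
        0, h, i, 0, 0, 0, 0, 0;
        0, k, 0, l, 0, 0, 0, 0;
        C 0 0, C 0 1, C 0 2, C 0 3, a', b', c', d';
        C 1 0, C 1 1, C 1 2, C 1 3, 0, e', f', g';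
        C 2 0, C 2 1, C 2 2, C 2 3, 0, h', i', 0;
        C 3 0, C 3 1, C 3 2, C 3 3, 0, k', 0, l'] : Matrix (Fin 8) (Fin 8) ℝ).det
      = (a * (e * i * l - f * h * l - g * k * i)) *
        (a' * (e' * i' * l' - f' * h' * l' - g' * k' * i')) := by
  rw [← aux_det4 a b c d, ← aux_det4 a' b' c' d', ← Matrix.det_fromBlocks_zero₁₂ _ C,
    ← Matrix.det_submatrix_equiv_self (finSumFinEquiv : Fin 4 ⊕ Fin 4 ≃ Fin 8)]
  congr 1
  ext x y
  rcases x with x | x <;> rcases y with y | y <;> fin_cases x <;> fin_cases y <;> rfl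

lemma aux_mem (F V : Matrix (Fin 8) (Fin 8) ℝ) (hV : V.det ≠ 0) (r : ℝ) :
    r ∈ spectrum ℝ (F * V⁻¹) ↔ (r • V - F).det = 0 := by
  have h1 : r • V - F = (algebraMap ℝ (Matrix (Fin 8) (Fin 8) ℝ) r - F * V⁻¹) * V := by
    rw [sub_mul, Matrix.mul_assoc, Matrix.nonsing_inv_mul _ (isUnit_iff_ne_zero.mpr hV),
      Matrix.mul_one, Algebra.algebraMap_eq_smul_one, Matrix.smul_mul, Matrix.one_mul]
  rw [spectrum.mem_iff, Matrix.isUnit_iff_isUnit_det, isUnit_iff_ne_zero, not_not, h1,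
    Matrix.det_mul]
  simp [hV]

/-- The next-generation matrix of the asymmetric two-node SICA network has
nonzero eigenvalues exactly `R01` and `R02`, and its spectral radius is
`max R01 R02`. -/
theorem two_node_next_generation_spectrum
    (Λ₁ Λ₂ β₁ β₂ ηC₁ ηA₁ ηC₂ ηA₂ μ₁ μ₂ ρ₁ ρ₂ φ₁ φ₂ ω₁ ω₂ α₁ α₂ d₁ d₂ : ℝ)
    (εS εI εC εA L21 : ℝ)
    (hΛ₁ : 0 < Λ₁) (hΛ₂ : 0 < Λ₂) (hβ₁ : 0 < β₁) (hβ₂ : 0 < β₂)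
    (hηC₁ : 0 < ηC₁) (hηA₁ : 0 < ηA₁) (hηC₂ : 0 < ηC₂) (hηA₂ : 0 < ηA₂)
    (hμ₁ : 0 < μ₁) (hμ₂ : 0 < μ₂) (hρ₁ : 0 < ρ₁) (hρ₂ : 0 < ρ₂)
    (hφ₁ : 0 < φ₁) (hφ₂ : 0 < φ₂) (hω₁ : 0 < ω₁) (hω₂ : 0 < ω₂)
    (hα₁ : 0 < α₁) (hα₂ : 0 < α₂) (hd₁ : 0 < d₁) (hd₂ : 0 < d₂)
    (hεS : 0 < εS) (hεI : 0 < εI) (hεC : 0 < εC) (hεA : 0 < εA) (hL : 0 < L21)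
    -- abbreviations
    (ξ₁₁ ξ₂₁ ξ₁₂ ξ₂₂ S10 S20 N₁ D₁ N₂ D₂ p₀ p₁ p₂ R01 R02 : ℝ)
    (hξ₁₁ : ξ₁₁ = α₁ + μ₁ + d₁) (hξ₂₁ : ξ₂₁ = ω₁ + μ₁)
    (hξ₁₂ : ξ₁₂ = α₂ + μ₂ + d₂) (hξ₂₂ : ξ₂₂ = ω₂ + μ₂)
    (hS10 : S10 = Λ₁ / (L21 * εS + μ₁))
    (hS20 : S20 = (L21 * εS * (Λ₁ + Λ₂) + Λ₂ * μ₁) / (μ₂ * (L21 * εS + μ₁)))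
    (hN₁ : N₁ = Λ₁ * β₁ * (L21 ^ 2 * εA * εC
        + (ηA₁ * ρ₁ * εC + ηC₁ * φ₁ * εA + ξ₁₁ * εC + ξ₂₁ * εA) * L21
        + ξ₂₁ * (ξ₁₁ + ρ₁ * ηA₁) + ξ₁₁ * ηC₁ * φ₁))
    (hp₀ : p₀ = μ₁ * (ξ₂₁ * (ρ₁ + ξ₁₁) + φ₁ * ξ₁₁ + d₁ * ρ₁) + d₁ * ω₁ * ρ₁)
    (hp₁ : p₁ = (ξ₁₁ * (μ₁ + φ₁) + (d₁ + μ₁) * ρ₁) * εC + ξ₁₁ * ξ₂₁ * εI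
        + ((μ₁ + ρ₁) * ξ₂₁ + μ₁ * φ₁) * εA)
    (hp₂ : p₂ = ((ρ₁ + φ₁ + μ₁) * εA + εI * ξ₁₁) * εC + εA * εI * ξ₂₁)
    (hD₁ : D₁ = (L21 * εS + μ₁) * (L21 ^ 3 * εA * εC * εI + p₂ * L21 ^ 2 + p₁ * L21 + p₀))
    (hN₂ : N₂ = β₂ * (ξ₂₂ * (ξ₁₂ + ρ₂ * ηA₂) + ηC₂ * φ₂ * ξ₁₂))
    (hD₂ : D₂ = μ₂ * (ξ₂₂ * (ρ₂ + ξ₁₂) + φ₂ * ξ₁₂ + ρ₂ * d₂) + ρ₂ * ω₂ * d₂)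
    (hR01 : R01 = N₁ / D₁)
    (hR02 : R02 = N₂ * (Λ₁ * L21 * εS + Λ₂ * L21 * εS + Λ₂ * μ₁)
        / (D₂ * ((L21 * εS + μ₁) * μ₂)))
    -- Jacobian of new-infection terms at the DFE
    (F₀ : Matrix (Fin 8) (Fin 8) ℝ)
    (hF₀ : F₀ = !![0, 0, 0, 0, 0, 0, 0, 0;
                   0, β₁ * S10, β₁ * S10 * ηC₁, β₁ * S10 * ηA₁, 0, 0, 0, 0;
                   0, 0, 0, 0, 0, 0, 0, 0;
                   0, 0, 0, 0, 0, 0, 0, 0;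
                   0, 0, 0, 0, 0, 0, 0, 0;
                   0, L21 * εI, 0, 0, 0, β₂ * S20, β₂ * S20 * ηC₂, β₂ * S20 * ηA₂;
                   0, 0, 0, 0, 0, 0, 0, 0;
                   0, 0, 0, 0, 0, 0, 0, 0])
    -- Jacobian of transfer terms at the DFE
    (V₀ : Matrix (Fin 8) (Fin 8) ℝ)
    (hV₀ : V₀ = !![L21 * εS + μ₁, β₁ * S10, β₁ * S10 * ηC₁, β₁ * S10 * ηA₁, 0, 0, 0, 0;
                   0, L21 * εI + μ₁ + φ₁ + ρ₁, -ω₁, -α₁, 0, 0, 0, 0;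
                   0, -φ₁, L21 * εC + ξ₂₁, 0, 0, 0, 0, 0;
                   0, -ρ₁, 0, L21 * εA + ξ₁₁, 0, 0, 0, 0;
                   -(L21 * εS), 0, 0, 0, μ₂, β₂ * S20, β₂ * S20 * ηC₂, β₂ * S20 * ηA₂;
                   0, 0, 0, 0, 0, ρ₂ + φ₂ + μ₂, -ω₂, -α₂;
                   0, 0, -(L21 * εC), 0, 0, -φ₂, ξ₂₂, 0;
                   0, 0, 0, -(L21 * εA), 0, -ρ₂, 0, ξ₁₂]) :
    spectrum ℝ (F₀ * V₀⁻¹) = {0, R01, R02} ∧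
    IsGreatest (abs '' spectrum ℝ (F₀ * V₀⁻¹)) (max R01 R02) := by
  have hξ₁₁p : 0 < ξ₁₁ := by rw [hξ₁₁]; positivity
  have hξ₂₁p : 0 < ξ₂₁ := by rw [hξ₂₁]; positivity
  have hξ₁₂p : 0 < ξ₁₂ := by rw [hξ₁₂]; positivity
  have hξ₂₂p : 0 < ξ₂₂ := by rw [hξ₂₂]; positivity
  have hp₀p : 0 < p₀ := by rw [hp₀]; positivity
  have hp₁p : 0 < p₁ := by rw [hp₁]; positivity
  have hp₂p : 0 < p₂ := by rw [hp₂]; positivity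
  obtain ⟨Δ₁, hΔ₁⟩ : ∃ x, x = L21 ^ 3 * εA * εC * εI + p₂ * L21 ^ 2 + p₁ * L21 + p₀ := ⟨_, rfl⟩
  have hΔ₁p : 0 < Δ₁ := by rw [hΔ₁]; positivity
  have hD₂p : 0 < D₂ := by rw [hD₂]; positivity
  obtain ⟨m, hm⟩ : ∃ x, x = L21 * εS + μ₁ := ⟨_, rfl⟩
  have hmp : 0 < m := by rw [hm]; positivity
  have hN₁p : 0 < N₁ := by rw [hN₁]; positivity
  have hN₂p : 0 < N₂ := by rw [hN₂]; positivity
  rw [← hΔ₁, ← hm] at hD₁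
  rw [← hm] at hR02 hS10 hS20 hV₀
  have hR01p : 0 < R01 := by rw [hR01, hD₁]; positivity
  have hR02p : 0 < R02 := by rw [hR02]; positivity
  have e1 : β₁ * S10 * ((L21 * εC + ξ₂₁) * (L21 * εA + ξ₁₁) + ηC₁ * φ₁ * (L21 * εA + ξ₁₁)
      + ηA₁ * ρ₁ * (L21 * εC + ξ₂₁)) = Δ₁ * R01 := by
    rw [hR01, hD₁, hS10, hN₁]; field_simp; ring
  have e2 : S20 * N₂ = D₂ * R02 := by
    rw [hR02, hS20]; field_simp
  have f1 : (L21 * εI + μ₁ + φ₁ + ρ₁) * (L21 * εC + ξ₂₁) * (L21 * εA + ξ₁₁)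
      - ω₁ * φ₁ * (L21 * εA + ξ₁₁) - α₁ * ρ₁ * (L21 * εC + ξ₂₁) = Δ₁ := by
    rw [hΔ₁, hp₀, hp₁, hp₂, hξ₁₁, hξ₂₁]; ring
  have f2 : (ρ₂ + φ₂ + μ₂) * ξ₂₂ * ξ₁₂ - ω₂ * φ₂ * ξ₁₂ - α₂ * ρ₂ * ξ₂₂ = D₂ := by
    rw [hD₂, hξ₁₂, hξ₂₂]; ring
  have hdet : ∀ r s : ℝ, (r • V₀ - s • F₀).det
      = (r * m * (r ^ 2 * (r * Δ₁ - s * (Δ₁ * R01)))) *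
        (r * μ₂ * (r ^ 2 * (r * D₂ - s * (D₂ * R02)))) := by
    intro r s
    have := aux_det8 (r * m) (r * (β₁ * S10)) (r * (β₁ * S10 * ηC₁)) (r * (β₁ * S10 * ηA₁))
      (r * (L21 * εI + μ₁ + φ₁ + ρ₁) - s * (β₁ * S10)) (r * -ω₁ - s * (β₁ * S10 * ηC₁))
      (r * -α₁ - s * (β₁ * S10 * ηA₁)) (r * -φ₁) (r * (L21 * εC + ξ₂₁)) (r * -ρ₁)
      (r * (L21 * εA + ξ₁₁))
      (r * μ₂) (r * (β₂ * S20)) (r * (β₂ * S20 * ηC₂)) (r * (β₂ * S20 * ηA₂))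
      (r * (ρ₂ + φ₂ + μ₂) - s * (β₂ * S20)) (r * -ω₂ - s * (β₂ * S20 * ηC₂))
      (r * -α₂ - s * (β₂ * S20 * ηA₂)) (r * -φ₂) (r * ξ₂₂) (r * -ρ₂) (r * ξ₁₂)
      !![r * -(L21 * εS), 0, 0, 0; 0, 0 - s * (L21 * εI), 0, 0;
         0, 0, r * -(L21 * εC), 0; 0, 0, 0, r * -(L21 * εA)]
    refine Eq.trans ?_ (this.trans ?_)
    · congr 1
      rw [hV₀, hF₀]
      simp
      refine ⟨?_, ?_, ?_, ?_⟩ <;> (ext i; fin_cases i <;> rfl)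
    · rw [← e1, ← e2, ← f1, ← f2, hN₂]
      ring
  have hVdet : V₀.det ≠ 0 := by
    have := hdet 1 0
    simp only [one_smul, zero_smul, sub_zero] at this
    rw [this]
    have : 0 < (1 * m * (1 ^ 2 * (1 * Δ₁ - 0 * (Δ₁ * R01)))) *
        (1 * μ₂ * (1 ^ 2 * (1 * D₂ - 0 * (D₂ * R02)))) := by
      simp only [one_mul, zero_mul, sub_zero, one_pow]; positivity
    exact this.ne'
  have hspec : spectrum ℝ (F₀ * V₀⁻¹) = {0, R01, R02} := by
    ext r
    rw [aux_mem F₀ V₀ hVdet r]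
    have h := hdet r 1
    rw [one_smul] at h
    have h' : (r • V₀ - F₀).det = (m * Δ₁ * μ₂ * D₂) * (r ^ 6 * ((r - R01) * (r - R02))) := by
      rw [h]; ring
    have hc : m * Δ₁ * μ₂ * D₂ ≠ 0 := by positivity
    rw [h', mul_eq_zero_iff_left hc, mul_eq_zero, mul_eq_zero, pow_eq_zero_iff (by norm_num),
      sub_eq_zero, sub_eq_zero]
    simp only [Set.mem_insert_iff, Set.mem_singleton_iff]
  refine ⟨hspec, ?_⟩
  rw [hspec]
  constructor
  · rcases le_total R01 R02 with h | h
    · exact ⟨R02, by simp, by rw [max_eq_right h, abs_of_pos hR02p]⟩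
    · exact ⟨R01, by simp, by rw [max_eq_left h, abs_of_pos hR01p]⟩
  · rintro _ ⟨x, hx, rfl⟩
    rcases hx with rfl | rfl | rfl
    · rw [abs_zero]; exact hR01p.le.trans (le_max_left _ _)
    · rw [abs_of_pos hR01p]; exact le_max_left _ _
    · rw [abs_of_pos hR02p]; exact le_max_right _ _
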